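/- For every integer m ≥ 1 and every nonzero v in span{φ₋, φ₊, φ₂}, where φ₋ = (1, 1−λ₋, λ₋−1, −1)ᵀ⊗𝟙, φ₊ = (1, 1−λ₊, λ₊−1, −1)ᵀ⊗𝟙, φ₂ = (1, −1, −1, 1)ᵀ⊗𝟙, one has ⟨L_* v, v⟩ ≥ λ₋ ⟨v, v⟩, with equality attained at v = φ₋; i.e., the minimum of the Rayleigh quotient ⟨L_* v, v⟩/⟨v, v⟩ over nonzero v in this span equals λ₋ = m + 1 − √(m² + 1). -/

import Mathlib

open Matrix Polynomial

/-- `lamMinus m` is the eigenvalue `m + 1 - sqrt (m^2 + 1)`. -/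
noncomputable def lamMinus (m : ℕ) : ℝ := m + 1 - Real.sqrt ((m : ℝ) ^ 2 + 1)

/-- `lamPlus m` is the eigenvalue `m + 1 + sqrt (m^2 + 1)`. -/
noncomputable def lamPlus (m : ℕ) : ℝ := m + 1 + Real.sqrt ((m : ℝ) ^ 2 + 1)

/-- The matrix `L_*` on `ℝ^{4m}`, indexed by pairs `(b, p)` where `b : Fin 4` is the block
index and `p : Fin m` is the position within the block.  In 4×4 block form with m×m blocks,
`L_* = [[I, -I, 0, 0], [-I, (m+1)I, -J, 0], [0, -J, (m+1)I, -I], [0, 0, -I, I]]`,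
where `J` is the all-ones matrix. -/
def Lstar (m : ℕ) : Matrix (Fin 4 × Fin m) (Fin 4 × Fin m) ℝ := fun i j =>
  if i.1 = j.1 then
    (if i.1.val = 0 ∨ i.1.val = 3 then (if i.2 = j.2 then 1 else 0)
     else ((m : ℝ) + 1) * (if i.2 = j.2 then 1 else 0))
  else if (i.1.val = 0 ∧ j.1.val = 1) ∨ (i.1.val = 1 ∧ j.1.val = 0) ∨
          (i.1.val = 2 ∧ j.1.val = 3) ∨ (i.1.val = 3 ∧ j.1.val = 2) then
    (if i.2 = j.2 then -1 else 0)
  else if (i.1.val = 1 ∧ j.1.val = 2) ∨ (i.1.val = 2 ∧ j.1.val = 1) then -1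
  else 0

/-- `tensor c ξ` is the vector `(c 0, c 1, c 2, c 3)ᵀ ⊗ ξ` in `ℝ^{4m}`:
its four consecutive blocks of length `m` are `c 0 • ξ`, `c 1 • ξ`, `c 2 • ξ`, `c 3 • ξ`. -/
def tensor {m : ℕ} (c : Fin 4 → ℝ) (ξ : Fin m → ℝ) : Fin 4 × Fin m → ℝ := fun i => c i.1 * ξ i.2

theorem Lstar_mulVec_tensor (m : ℕ) (a b c d : ℝ) :
    (Lstar m).mulVec (tensor ![a, b, c, d] (fun _ => 1)) =
      tensor ![a - b, -a + (m + 1) * b - m * c, -m * b + (m + 1) * c - d, d - c] (fun _ => 1) := by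
  ext ⟨i, p⟩
  simp only [Matrix.mulVec, dotProduct, Fintype.sum_prod_type, Fin.sum_univ_four]
  fin_cases i <;> simp [Lstar, tensor] <;> ring

theorem tensor_dot (m : ℕ) (a b c d a' b' c' d' : ℝ) :
    (tensor ![a, b, c, d] (fun _ => 1) : Fin 4 × Fin m → ℝ) ⬝ᵥ
      tensor ![a', b', c', d'] (fun _ => 1) = m * (a * a' + b * b' + c * c' + d * d') := by
  simp only [dotProduct, Fintype.sum_prod_type, Fin.sum_univ_four]
  simp [tensor]
  ring

/-- For every integer `m ≥ 1` and every nonzero `v` in `span {φ₋, φ₊, φ₂}`, one has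
`⟨L_* v, v⟩ ≥ λ₋ ⟨v, v⟩`, with equality attained at `v = φ₋`; i.e. the minimum of the
Rayleigh quotient over nonzero vectors in this span equals `λ₋ = m + 1 - √(m² + 1)`. -/
theorem stmt11 (m : ℕ) (hm : 1 ≤ m) :
    (∀ v : Fin 4 × Fin m → ℝ,
        v ∈ Submodule.span ℝ
          {tensor ![1, 1 - lamMinus m, lamMinus m - 1, -1] (fun _ => 1), tensor ![1, 1 - lamPlus m, lamPlus m - 1, -1] (fun _ => 1), tensor ![1, -1, -1, 1] (fun _ => 1)} →
        v ≠ 0 → (Lstar m).mulVec v ⬝ᵥ v ≥ lamMinus m * (v ⬝ᵥ v)) ∧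
    (Lstar m).mulVec (tensor ![1, 1 - lamMinus m, lamMinus m - 1, -1] (fun _ => 1)) ⬝ᵥ ((tensor ![1, 1 - lamMinus m, lamMinus m - 1, -1] (fun _ => 1) : Fin 4 × Fin m → ℝ)) =
      lamMinus m * (((tensor ![1, 1 - lamMinus m, lamMinus m - 1, -1] (fun _ => 1) : Fin 4 × Fin m → ℝ)) ⬝ᵥ (tensor ![1, 1 - lamMinus m, lamMinus m - 1, -1] (fun _ => 1))) := by
  obtain ⟨s, hs⟩ : ∃ s, s = Real.sqrt ((m : ℝ) ^ 2 + 1) := ⟨_, rfl⟩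
  have hs0 : 0 ≤ s := hs ▸ Real.sqrt_nonneg _
  have hs2 : s ^ 2 = (m : ℝ) ^ 2 + 1 := by
    rw [hs]; exact Real.sq_sqrt (by positivity)
  have hm0 : (0 : ℝ) ≤ m := Nat.cast_nonneg m
  have hsm : (m : ℝ) ≤ s := by nlinarith
  simp only [lamMinus, lamPlus, ← hs]
  constructor
  · intro v hv _
    rw [Submodule.mem_span_insert] at hv
    obtain ⟨x, w, hw, rfl⟩ := hv
    rw [Submodule.mem_span_pair] at hw
    obtain ⟨y, z, rfl⟩ := hw
    have key : ∀ (f g h : Fin 4 → ℝ),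
        (x • tensor f (fun _ => 1) + (y • tensor g (fun _ => 1) + z • tensor h (fun _ => 1))
          : Fin 4 × Fin m → ℝ) =
        tensor ![x * f 0 + y * g 0 + z * h 0, x * f 1 + y * g 1 + z * h 1,
          x * f 2 + y * g 2 + z * h 2, x * f 3 + y * g 3 + z * h 3] (fun _ => 1) := by
      intro f g h
      ext ⟨i, p⟩
      fin_cases i <;> simp [tensor] <;> ring
    rw [key, Lstar_mulVec_tensor, tensor_dot, tensor_dot]
    simp only [Matrix.cons_val]
    have hpos : 0 ≤ (m : ℝ) * (2 * s * y ^ 2 * (2 + 2 * (m + s) ^ 2) +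
        4 * (1 - m + s) * z ^ 2) := by
      have : 0 ≤ 1 - (m : ℝ) + s := by linarith
      positivity
    rw [ge_iff_le, ← sub_nonneg]
    refine hpos.trans (le_of_eq ?_)
    generalize (m : ℝ) = t at *
    linear_combination (-2 * t * ((s - t) * x ^ 2 - 2 * (s + t) * x * y - (s + t) * y ^ 2)) * hs2
  · rw [Lstar_mulVec_tensor, tensor_dot, tensor_dot]
    generalize (m : ℝ) = t at *
    linear_combination (2 * t * (s - t)) * hs2
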